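/- Let λ₁, λ₂, λ₃ ∈ ℝ, let [·,·] be the Table 1 bracket on ℝ⁶, g the Norden metric, R(x,y,z,u) := −(1/4)·g([x,y],[z,u]), εᵢ := g(eᵢ,eᵢ), ρ(y,z) := Σ_{i=1}^{6} εᵢ·R(eᵢ,y,z,eᵢ), and τ := Σ_{j=1}^{6} εⱼ·ρ(eⱼ,eⱼ). Then τ = 0, i.e. the manifold (G,J,g) is scalar flat. -/

import Mathlib

noncomputable section

open Finset

/-- Component `k` of the Table 1 bracket `[e_i, e_j]` (indices 0–5 for e₁–e₆). -/
def tbl (l1 l2 l3 : ℝ) : Fin 6 → Fin 6 → Fin 6 → ℝ :=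
  let v12 : Fin 6 → ℝ := ![0, 0, 0, l2, l3, 0]
  let v13 : Fin 6 → ℝ := ![0, 0, 0, -l1, 0, -l3]
  let v14 : Fin 6 → ℝ := ![0, l2, -l1, 0, l2, -l1]
  let v15 : Fin 6 → ℝ := ![0, l3, 0, -l2, 0, 0]
  let v16 : Fin 6 → ℝ := ![0, 0, -l3, l1, 0, 0]
  let v23 : Fin 6 → ℝ := ![0, 0, 0, 0, l1, l2]
  let v24 : Fin 6 → ℝ := ![-l2, 0, 0, 0, l3, 0]
  let v25 : Fin 6 → ℝ := ![-l3, 0, l1, -l3, 0, l1]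
  let v26 : Fin 6 → ℝ := ![0, 0, l2, 0, -l1, 0]
  let v34 : Fin 6 → ℝ := ![l1, 0, 0, 0, 0, -l3]
  let v35 : Fin 6 → ℝ := ![0, -l1, 0, 0, 0, l2]
  let v36 : Fin 6 → ℝ := ![l3, -l2, 0, l3, -l2, 0]
  let v45 : Fin 6 → ℝ := ![-l2, -l3, 0, 0, 0, 0]
  let v46 : Fin 6 → ℝ := ![l1, 0, l3, 0, 0, 0]
  let v56 : Fin 6 → ℝ := ![0, -l1, -l2, 0, 0, 0]
  ![![0, v12, v13, v14, v15, v16],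
    ![-v12, 0, v23, v24, v25, v26],
    ![-v13, -v23, 0, v34, v35, v36],
    ![-v14, -v24, -v34, 0, v45, v46],
    ![-v15, -v25, -v35, -v45, 0, v56],
    ![-v16, -v26, -v36, -v46, -v56, 0]]

/-- The Table 1 bracket on ℝ⁶, extended bilinearly. -/
def br (l1 l2 l3 : ℝ) (x y : Fin 6 → ℝ) : Fin 6 → ℝ :=
  fun k => ∑ i : Fin 6, ∑ j : Fin 6, x i * y j * tbl l1 l2 l3 i j k

/-- The standard basis of ℝ⁶. -/
def e (i : Fin 6) : Fin 6 → ℝ := Pi.single i 1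

/-- The signs of the Norden metric. -/
def eps : Fin 6 → ℝ := ![1, 1, 1, -1, -1, -1]

/-- The Norden metric: diagonal with entries (1,1,1,-1,-1,-1). -/
def gN (x y : Fin 6 → ℝ) : ℝ := ∑ i : Fin 6, eps i * x i * y i

/-- The almost complex structure: J eᵢ = e_{i+3}, J e_{i+3} = −eᵢ (i = 1,2,3). -/
def JN (x : Fin 6 → ℝ) : Fin 6 → ℝ := ![-x 3, -x 4, -x 5, x 0, x 1, x 2]

/-- The fundamental tensor F(x,y,z) = g((∇ₓJ)y, z) with ∇ₓy = (1/2)[x,y]. -/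
def FT (l1 l2 l3 : ℝ) (x y z : Fin 6 → ℝ) : ℝ :=
  (1/2 : ℝ) * (gN (br l1 l2 l3 x (JN y)) z - gN (br l1 l2 l3 x y) (JN z))

/-- The (0,4)-curvature tensor R(x,y,z,u) = −(1/4)g([x,y],[z,u]). -/
def RT (l1 l2 l3 : ℝ) (x y z u : Fin 6 → ℝ) : ℝ :=
  -(1/4 : ℝ) * gN (br l1 l2 l3 x y) (br l1 l2 l3 z u)

/-- The Ricci tensor ρ(y,z) = Σᵢ εᵢ R(eᵢ,y,z,eᵢ). -/
def ricT (l1 l2 l3 : ℝ) (y z : Fin 6 → ℝ) : ℝ :=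
  ∑ i : Fin 6, eps i * RT l1 l2 l3 (e i) y z (e i)

/-- The sectional curvature of the plane spanned by x, y. -/
def kT (l1 l2 l3 : ℝ) (x y : Fin 6 → ℝ) : ℝ :=
  RT l1 l2 l3 x y y x / (gN x x * gN y y - gN x y ^ 2)

/-- The matrix of ad x : v ↦ [x,v]. -/
def adM (l1 l2 l3 : ℝ) (x : Fin 6 → ℝ) : Matrix (Fin 6) (Fin 6) ℝ :=
  Matrix.of fun k j => br l1 l2 l3 x (e j) k

/-- The Killing form B(x,y) = tr(ad x ∘ ad y). -/
def KB (l1 l2 l3 : ℝ) (x y : Fin 6 → ℝ) : ℝ :=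
  Matrix.trace (adM l1 l2 l3 x * adM l1 l2 l3 y)

theorem br_e_e (l1 l2 l3 : ℝ) (i j : Fin 6) : br l1 l2 l3 (e i) (e j) = tbl l1 l2 l3 i j := by
  ext k
  simp [br, e, Pi.single_apply]

/-- Proposition 4.2: the scalar curvature τ = Σⱼ εⱼ ρ(eⱼ,eⱼ) vanishes, i.e. the
manifold (G,J,g) is scalar flat. -/
theorem table1_scalar_flat (l1 l2 l3 : ℝ) :
    ∑ j : Fin 6, eps j * ricT l1 l2 l3 (e j) (e j) = 0 := by
  simp only [ricT, RT, br_e_e, gN, Fin.sum_univ_six]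
  simp [eps, tbl]
  ring
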